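/- Let $(R,\mathfrak{m})$ be a commutative Noetherian complete local ring, $I$ an ideal of $R$, $M$ a non-zero $I$-cofinite $R$-module, and $z \in \mathfrak{m}$ an element which is a nonzerodivisor on $M$. Then $\operatorname{Ann}_R H^1_{Rz}(M) = \operatorname{Ann}_R M$, where $H^1_{Rz}(M)$ is the first local cohomology module of $M$ with respect to the principal ideal $Rz$. -/

import Mathlib

open CategoryTheory

noncomputable section

/-- An `R`-module `M` is `I`-cofinite if `Supp M ⊆ V(I)` and `Ext^i_R(R/I, M)` is a finitely
generated `R`-module for all `i ≥ 0`. -/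
def IsCofinite (R : Type) [CommRing R] (I : Ideal R) (M : Type) [AddCommGroup M]
    [Module R M] : Prop :=
  Module.support R M ⊆ PrimeSpectrum.zeroLocus (I : Set R) ∧
    ∀ i : ℕ, Module.Finite R
      (((Ext R (ModuleCat.{0} R) i).obj (Opposite.op (ModuleCat.of R (R ⧸ I)))).obj
        (ModuleCat.of R M))

section
variable {R : Type*} [CommRing R] {M : Type*} [AddCommGroup M] [Module R M]

/-- The quotient `M_z / M`, which is the first local cohomology of `M` when `z` is a
nonzerodivisor on `M`. -/
abbrev LocalizedQuotient (z : R) (M : Type*) [AddCommGroup M] [Module R M] : Type _ :=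
  LocalizedModule (Submonoid.powers z) M ⧸
    LinearMap.range (LocalizedModule.mkLinearMap (Submonoid.powers z) M)

namespace LocalizedQuotient

/-- The map `M → M_z / M` sending `m` to the class of `m / z ^ n`. -/
def frac (z : R) (M : Type*) [AddCommGroup M] [Module R M] (n : ℕ) :
    M →ₗ[R] LocalizedQuotient z M :=
  Submodule.mkQ _ ∘ₗ LocalizedModule.divBy ⟨z ^ n, n, rfl⟩ ∘ₗ
    LocalizedModule.mkLinearMap (Submonoid.powers z) M

variable (z : R)

lemma frac_apply (n : ℕ) (m : M) : frac z M n m =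
    Submodule.Quotient.mk (LocalizedModule.mk m (⟨z ^ n, n, rfl⟩ : Submonoid.powers z)) := by
  simp [frac, LocalizedModule.mkLinearMap_apply, LocalizedModule.divBy_apply,
    LocalizedModule.liftOn_mk]

lemma frac_pow_smul_self (n : ℕ) (m : M) : frac z M n (z ^ n • m) = 0 := by
  rw [frac_apply, Submodule.Quotient.mk_eq_zero]
  exact ⟨m, (LocalizedModule.mk_cancel (⟨z ^ n, n, rfl⟩ : Submonoid.powers z) m).symm⟩

lemma frac_add_pow_smul (n k : ℕ) (m : M) : frac z M (n + k) (z ^ k • m) = frac z M n m := by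
  rw [frac_apply, frac_apply]
  congr 1
  rw [LocalizedModule.mk_eq]
  exact ⟨1, by simp [Submonoid.smul_def, smul_smul, pow_add]⟩

lemma exists_frac_eq (a : LocalizedQuotient z M) : ∃ n m, frac z M n m = a := by
  obtain ⟨a, rfl⟩ := Submodule.Quotient.mk_surjective _ a
  induction a using LocalizedModule.induction_on with
  | h m s =>
    obtain ⟨_, n, rfl⟩ := s
    exact ⟨n, m, frac_apply z n m⟩

variable {z}

lemma exists_eq_pow_smul_of_frac_eq_zero (hreg : IsSMulRegular M z) {n : ℕ} {m : M}
    (h : frac z M n m = 0) : ∃ m', m = z ^ n • m' := by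
  rw [frac_apply, Submodule.Quotient.mk_eq_zero] at h
  obtain ⟨m', h⟩ := h
  rw [LocalizedModule.mkLinearMap_apply, LocalizedModule.mk_eq] at h
  obtain ⟨⟨_, k, rfl⟩, h⟩ := h
  refine ⟨m', ?_⟩
  simp only [Submonoid.smul_def, one_smul] at h
  exact (hreg.pow k h).symm

end LocalizedQuotient

open LocalizedQuotient in
lemma smul_eq_zero_of_mem_annihilator_localizedQuotient {z : R}
    (hreg : IsSMulRegular M z) {r : R}
    (hr : r ∈ Module.annihilator R (LocalizedQuotient z M)) (n : ℕ) (m : M) :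
    ∃ m', r • m = z ^ n • m' :=
  exists_eq_pow_smul_of_frac_eq_zero hreg (by rw [map_smul, Module.mem_annihilator.mp hr])

/-- The submodule of elements killed by `I ^ n` is finitely generated as soon as
the submodule of elements killed by `I` is. -/
lemma finite_torsionBySet_pow [IsNoetherianRing R] (I : Ideal R)
    (h : Module.Finite R (Submodule.torsionBySet R M I)) (n : ℕ) :
    Module.Finite R (Submodule.torsionBySet R M (I ^ n : Ideal R)) := by
  induction n with
  | zero =>
    have : Submodule.torsionBySet R M ((I ^ 0 : Ideal R) : Set R) = ⊥ := by
      rw [eq_bot_iff]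
      intro x hx
      rw [Submodule.mem_torsionBySet_iff] at hx
      simpa using hx ⟨1, by simp⟩
    rw [this]
    infer_instance
  | succ n ih =>
    obtain ⟨s, hs⟩ := IsNoetherian.noetherian I
    let N := Submodule.torsionBySet R M (I ^ (n + 1) : Ideal R)
    let f : N →ₗ[R] (s → Submodule.torsionBySet R M (I ^ n : Ideal R)) :=
      LinearMap.pi fun a => LinearMap.codRestrict _ (LinearMap.lsmul R M a.1 ∘ₗ N.subtype) (by
        rintro ⟨x, hx⟩
        rw [Submodule.mem_torsionBySet_iff] at hx ⊢
        rintro ⟨b, hb⟩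
        have ha : a.1 ∈ I := hs ▸ Submodule.subset_span a.2
        have := hx ⟨b * a.1, pow_succ I n ▸ Ideal.mul_mem_mul hb ha⟩
        simpa [smul_smul] using this)
    have hker : ∀ x ∈ LinearMap.ker f, (x : M) ∈ Submodule.torsionBySet R M (I : Set R) := by
      intro x hx
      rw [← hs, Submodule.mem_torsionBySet_iff]
      change ∀ a : Submodule.span R (s : Set R), _
      rintro ⟨a, ha⟩
      have hle : Submodule.span R (s : Set R) ≤ Ideal.torsionOf R M (x : M) := by
        rw [Submodule.span_le]
        intro a ha
        have := congrFun (LinearMap.mem_ker.mp hx) ⟨a, ha⟩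
        exact (Ideal.mem_torsionOf_iff _ _).mpr (congrArg Subtype.val this)
      exact (Ideal.mem_torsionOf_iff _ _).mp (hle ha)
    have : Module.Finite R (LinearMap.ker f) :=
      Module.Finite.of_injective
        (LinearMap.codRestrict _ (N.subtype ∘ₗ (LinearMap.ker f).subtype) fun x => hker x x.2)
        (fun x y hxy => by
          have := congrArg Subtype.val hxy
          exact Subtype.ext (Subtype.ext this))
    exact Module.Finite.of_exact (g := f.rangeRestrict)
      (LinearMap.exact_iff.mpr (by simp) : Function.Exact (LinearMap.ker f).subtype f.rangeRestrict)
      f.surjective_rangeRestrict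

/-- Let `I` be an ideal such that `0 :_M I` is finitely generated and `M` is supported in `V(I)`,
and let `z` be a nonzerodivisor on `M` in the maximal ideal. Then `M` is `z`-adically
separated. -/
lemma eq_zero_of_forall_eq_pow_smul [IsNoetherianRing R] [IsLocalRing R] {I : Ideal R}
    (hsupp : Module.support R M ⊆ PrimeSpectrum.zeroLocus (I : Set R))
    (hfin : Module.Finite R (Submodule.torsionBySet R M I))
    {z : R} (hz : z ∈ IsLocalRing.maximalIdeal R) (hreg : IsSMulRegular M z)
    {m : M} (hm : ∀ n : ℕ, ∃ m', m = z ^ n • m') : m = 0 := by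
  obtain ⟨k, hk⟩ : ∃ k, I ^ k ≤ Ideal.torsionOf R M m := by
    apply Ideal.exists_pow_le_of_le_radical_of_fg _ (IsNoetherian.noetherian I)
    rw [Ideal.radical_eq_sInf]
    refine le_sInf fun p ⟨hp, hpp⟩ => ?_
    exact hsupp (Module.mem_support_iff_exists_annihilator.mpr ⟨m, by
      rwa [Submodule.annihilator_span_singleton]⟩ : (⟨p, hpp⟩ : PrimeSpectrum R) ∈ _)
  let N := Submodule.torsionBySet R M (I ^ k : Ideal R)
  have : Module.Finite R N := finite_torsionBySet_pow I hfin k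
  have hmN : m ∈ N := by
    rw [Submodule.mem_torsionBySet_iff]
    exact fun a => (Ideal.mem_torsionOf_iff _ _).mp (hk a.2)
  have : (⟨m, hmN⟩ : N) ∈ (⨅ i : ℕ, IsLocalRing.maximalIdeal R ^ i • ⊤ : Submodule R N) := by
    rw [Submodule.mem_iInf]
    intro n
    obtain ⟨m', hm'⟩ := hm n
    have : m' ∈ N := by
      rw [Submodule.mem_torsionBySet_iff]
      intro a
      apply hreg.pow n
      change z ^ n • a.1 • m' = z ^ n • 0
      rw [smul_comm, ← hm', smul_zero]
      exact (Ideal.mem_torsionOf_iff _ _).mp (hk a.2)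
    have h : (⟨m, hmN⟩ : N) = z ^ n • ⟨m', this⟩ := Subtype.ext hm'
    rw [h]
    exact Submodule.smul_mem_smul (Ideal.pow_mem_pow hz n) trivial
  rw [Ideal.iInf_pow_smul_eq_bot_of_isLocalRing _ (Ideal.IsPrime.ne_top inferInstance)] at this
  exact congrArg Subtype.val ((Submodule.mem_bot R).mp this)

end

section
variable {V : Type*} [Category V] [Abelian V] {K L : ChainComplex Vᵒᵖ ℕ}

/-- The morphism of cochain complexes opposite to a morphism of chain complexes. -/
def HomologicalComplex.unopMap (φ : K ⟶ L) : L.unop ⟶ K.unop :=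
  (HomologicalComplex.unopFunctor _ _).map φ.op

lemma HomologicalComplex.homologyUnop_inv_naturality (φ : K ⟶ L) (n : ℕ) :
    (homologyMap φ n).unop ≫ (K.homologyUnop n).inv =
      (L.homologyUnop n).inv ≫ homologyMap (unopMap φ) n := by
  have h : (L.homologyUnop n).hom ≫ (homologyMap φ n).unop =
      homologyMap (unopMap φ) n ≫ (K.homologyUnop n).hom :=
    congrArg Quiver.Hom.unop (homologyOp_hom_naturality (unopMap φ) n)
  rw [Iso.eq_inv_comp, ← Category.assoc, h, Category.assoc, Iso.hom_inv_id, Category.comp_id]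

end

section
universe w v u
variable {R : Type w} [Ring R] {C : Type u} [Category.{v} C] [Abelian C] [Linear R C]
  [EnoughProjectives C]

/-- The cochain map obtained by applying `Hom(-, Y)` to a chain map. -/
def ChainComplex.linearYonedaObjMap {K L : ChainComplex C ℕ} (φ : K ⟶ L) (Y : C) :
    L.linearYonedaObj R Y ⟶ K.linearYonedaObj R Y :=
  HomologicalComplex.unopMap
    ((((linearYoneda R C).obj Y).rightOp.mapHomologicalComplex _).map φ)

lemma CategoryTheory.ProjectiveResolution.isoExt_hom_naturality {X X' : C} (f : X ⟶ X')
    (P : ProjectiveResolution X) (Q : ProjectiveResolution X')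
    (φ : P.complex ⟶ Q.complex) (comm : φ.f 0 ≫ Q.π.f 0 = P.π.f 0 ≫ f) (n : ℕ) (Y : C) :
    (((Ext R C n).map f.op).app Y) ≫ (P.isoExt n Y).hom =
      (Q.isoExt n Y).hom ≫
        HomologicalComplex.homologyMap (ChainComplex.linearYonedaObjMap φ Y) n := by
  have h := congrArg Quiver.Hom.unop
    (isoLeftDerivedObj_inv_naturality f P Q φ comm ((linearYoneda R C).obj Y).rightOp n)
  have h' := HomologicalComplex.homologyUnop_inv_naturality
    ((((linearYoneda R C).obj Y).rightOp.mapHomologicalComplex _).map φ) n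
  refine (Category.assoc _ _ _).symm.trans ?_
  refine (congrArg (· ≫ _) h).trans ?_
  refine (Category.assoc _ _ _).trans ?_
  refine Eq.trans ?_ (Category.assoc _ _ _).symm
  exact congrArg (_ ≫ ·) h'

end

section
open HomologicalComplex
variable {R : Type} [CommRing R]

/-- Evaluation of `R`-linear maps at an element. -/
def ModuleCat.evalAt {X : ModuleCat.{0} R} (M : ModuleCat.{0} R) (q : X) :
    ModuleCat.of R (X ⟶ M) ⟶ M :=
  ModuleCat.ofHom (LinearMap.applyₗ q ∘ₗ (ModuleCat.homLinearEquiv (S := R)).toLinearMap)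

lemma ModuleCat.evalAt_apply {X : ModuleCat.{0} R} (M : ModuleCat.{0} R) (q : X) (f : X ⟶ M) :
    ModuleCat.evalAt M q f = f q := rfl

namespace CategoryTheory.ProjectiveResolution
variable {X : ModuleCat.{0} R} (P : ProjectiveResolution X) {M : ModuleCat.{0} R}
  {A : ModuleCat.{0} R}

/-- The map out of `Ext¹(X, M)` induced by a map on `1`-cochains vanishing on coboundaries. -/
def extOneDesc (Φ : ModuleCat.of R (P.complex.X 1 ⟶ M) ⟶ A)
    (h : ∀ g : P.complex.X 0 ⟶ M, Φ (P.complex.d 1 0 ≫ g) = 0) :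
    ((Ext R (ModuleCat.{0} R) 1).obj (Opposite.op X)).obj M ⟶ A :=
  (P.isoExt 1 M).hom ≫ (P.complex.linearYonedaObj R M).homologyι 1 ≫
    (P.complex.linearYonedaObj R M).descOpcycles Φ 0 (by simp) (by
      ext g
      exact h g)

lemma isoExt_inv_extOneDesc (Φ : ModuleCat.of R (P.complex.X 1 ⟶ M) ⟶ A)
    (h : ∀ g : P.complex.X 0 ⟶ M, Φ (P.complex.d 1 0 ≫ g) = 0) :
    (P.complex.linearYonedaObj R M).homologyπ 1 ≫ (P.isoExt 1 M).inv ≫ P.extOneDesc Φ h =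
      (P.complex.linearYonedaObj R M).iCycles 1 ≫ Φ := by
  rw [extOneDesc, Iso.inv_hom_id_assoc, homology_π_ι_assoc]
  exact congrArg (_ ≫ ·) (p_descOpcycles _ _ _ _ _)

/-- A `1`-cocycle has a class in `Ext¹(X, M)`, on which `extOneDesc` is given by evaluation. -/
lemma exists_ext_class (f : P.complex.X 1 ⟶ M) (hf : P.complex.d 2 1 ≫ f = 0) :
    ∃ x : ((Ext R (ModuleCat.{0} R) 1).obj (Opposite.op X)).obj M,
      ∀ {A} (Φ : ModuleCat.of R (P.complex.X 1 ⟶ M) ⟶ A) h, P.extOneDesc Φ h x = Φ f := by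
  let K := P.complex.linearYonedaObj R M
  let k : ModuleCat.of R R ⟶ K.X 1 := ModuleCat.ofHom (LinearMap.toSpanSingleton R _ f)
  have hk : k ≫ K.d 1 2 = 0 := by
    ext
    change (P.complex.d 2 1 ≫ ((1 : R) • f)) = 0
    simp [hf]
  refine ⟨(P.isoExt 1 M).inv (K.homologyπ 1 (K.liftCycles k 2 (by simp) hk (1 : R))), ?_⟩
  intro A Φ h
  have : K.liftCycles k 2 (by simp) hk ≫ K.homologyπ 1 ≫ (P.isoExt 1 M).inv ≫
      P.extOneDesc Φ h = k ≫ Φ := by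
    rw [isoExt_inv_extOneDesc]
    exact liftCycles_i_assoc _ _ _ _ _ _
  have h1 := ConcreteCategory.congr_hom this (1 : R)
  refine Eq.trans h1 ?_
  change Φ ((1 : R) • f) = _
  rw [one_smul]

/-- Every class in `Ext¹(X', M)` is represented by a `1`-cocycle, compatibly with pullback along
a chain map lifting `α : X ⟶ X'`. -/
lemma exists_cocycle {X' : ModuleCat.{0} R} (α : X ⟶ X') (P' : ProjectiveResolution X')
    (φ : P.complex ⟶ P'.complex) (comm : φ.f 0 ≫ P'.π.f 0 = P.π.f 0 ≫ α)
    (x : ((Ext R (ModuleCat.{0} R) 1).obj (Opposite.op X')).obj M) :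
    ∃ f : P'.complex.X 1 ⟶ M, P'.complex.d 2 1 ≫ f = 0 ∧
      (∀ {A} (Φ : ModuleCat.of R (P'.complex.X 1 ⟶ M) ⟶ A) h, P'.extOneDesc Φ h x = Φ f) ∧
      (∀ {A} (Φ : ModuleCat.of R (P.complex.X 1 ⟶ M) ⟶ A) h,
        P.extOneDesc Φ h ((((Ext R (ModuleCat.{0} R) 1).map α.op).app M) x) = Φ (φ.f 1 ≫ f)) := by
  let K := P'.complex.linearYonedaObj R M
  let L := P.complex.linearYonedaObj R M
  have hsurj : Function.Surjective (K.homologyπ 1 ≫ (P'.isoExt 1 M).inv) :=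
    (ModuleCat.epi_iff_surjective _).mp inferInstance
  obtain ⟨c, rfl⟩ := hsurj x
  refine ⟨K.iCycles 1 c, ConcreteCategory.congr_hom (K.iCycles_d 1 2) c, ?_, ?_⟩
  · intro A Φ h
    have : (K.homologyπ 1 ≫ (P'.isoExt 1 M).inv) ≫ P'.extOneDesc Φ h = K.iCycles 1 ≫ Φ := by
      rw [Category.assoc, isoExt_inv_extOneDesc]
    exact ConcreteCategory.congr_hom this c
  · intro A Φ h
    have h2 : (P'.isoExt 1 M).inv ≫ ((Ext R (ModuleCat.{0} R) 1).map α.op).app M =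
        HomologicalComplex.homologyMap (ChainComplex.linearYonedaObjMap φ M) 1 ≫
          (P.isoExt 1 M).inv := by
      rw [Iso.inv_comp_eq, ← Category.assoc, Iso.eq_comp_inv]
      exact isoExt_hom_naturality α P P' φ comm 1 M
    have : (K.homologyπ 1 ≫ (P'.isoExt 1 M).inv) ≫
        ((Ext R (ModuleCat.{0} R) 1).map α.op).app M ≫ P.extOneDesc Φ h =
          K.iCycles 1 ≫ (ChainComplex.linearYonedaObjMap φ M).f 1 ≫ Φ := by
      rw [Category.assoc, ← Category.assoc (P'.isoExt 1 M).inv, h2, Category.assoc,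
        homologyπ_naturality_assoc, isoExt_inv_extOneDesc]
      exact cyclesMap_i_assoc _ _ _
    exact ConcreteCategory.congr_hom this c

lemma smul_ext_eq_zero (n : ℕ) {r : R} (hr : ∀ m : M, r • m = 0)
    (x : ((Ext R (ModuleCat.{0} R) n).obj (Opposite.op X)).obj M) : r • x = 0 := by
  let P := projectiveResolution X
  let K := P.complex.linearYonedaObj R M
  have hsurj : Function.Surjective (K.homologyπ n ≫ (P.isoExt n M).inv) :=
    (ModuleCat.epi_iff_surjective _).mp inferInstance
  obtain ⟨c, rfl⟩ := hsurj x
  have hc : r • c = 0 := by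
    apply (ModuleCat.mono_iff_injective (K.iCycles n)).mp inferInstance
    rw [map_smul, map_zero]
    refine ModuleCat.hom_ext (LinearMap.ext fun y => ?_)
    exact hr _
  rw [← map_smul, hc, map_zero]

end CategoryTheory.ProjectiveResolution

/-- `Ext⁰(X, M)` is `Hom(X, M)`. -/
def ModuleCat.extZeroIso (X M : ModuleCat.{0} R) :
    ((Ext R (ModuleCat.{0} R) 0).obj (Opposite.op X)).obj M ≅ ModuleCat.of R (X ⟶ M) :=
  have : Limits.PreservesFiniteLimits ((linearYoneda R (ModuleCat.{0} R)).obj M) := by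
    have : Limits.PreservesLimits
        ((linearYoneda R (ModuleCat.{0} R)).obj M ⋙ forget (ModuleCat.{0} R)) :=
      inferInstanceAs (Limits.PreservesLimits (yoneda.obj M))
    have : Limits.PreservesLimits ((linearYoneda R (ModuleCat.{0} R)).obj M) :=
      Limits.preservesLimits_of_reflects_of_preserves _ (forget (ModuleCat.{0} R))
    infer_instance
  have : Limits.PreservesFiniteColimits ((linearYoneda R (ModuleCat.{0} R)).obj M).rightOp :=
    Limits.preservesFiniteColimits_rightOp _
  ((((linearYoneda R (ModuleCat.{0} R)).obj M).rightOp.leftDerivedZeroIsoSelf).app X).symm.unop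

end

section
open CategoryTheory.ProjectiveResolution
variable {R : Type} [CommRing R]

lemma CategoryTheory.ProjectiveResolution.exists_lift_of_π_eq_zero {X : ModuleCat.{0} R}
    (P : ProjectiveResolution X) {p : P.complex.X 0} (hp : P.π.f 0 p = 0) :
    ∃ q : P.complex.X 1, P.complex.d 1 0 q = p :=
  (ShortComplex.moduleCat_exact_iff _).mp P.exact₀ p hp

lemma CategoryTheory.ProjectiveResolution.exists_lift_of_d_eq_zero {X : ModuleCat.{0} R}
    (P : ProjectiveResolution X) {p : P.complex.X 1} (hp : P.complex.d 1 0 p = 0) :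
    ∃ q : P.complex.X 2, P.complex.d 2 1 q = p :=
  (ShortComplex.moduleCat_exact_iff _).mp (P.exact_succ 0) p hp

lemma CategoryTheory.ProjectiveResolution.π_surjective {X : ModuleCat.{0} R}
    (P : ProjectiveResolution X) (x : X) : ∃ p : P.complex.X 0, P.π.f 0 p = x :=
  (ModuleCat.epi_iff_surjective (P.π.f 0)).mp inferInstance x

variable {J J' : Ideal R} (P : ProjectiveResolution (ModuleCat.of R (R ⧸ J)))
  (P' : ProjectiveResolution (ModuleCat.of R (R ⧸ J')))

/-- A lift `p` of `1 : R ⧸ J` to a projective resolution, together with a preimage `q` of `a • p`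
under the differential. -/
structure UnitLift (a : R) where
  p : P.complex.X 0
  q : P.complex.X 1
  π_p : (show R ⧸ J from P.π.f 0 p) = 1
  d_q : P.complex.d 1 0 q = a • p

lemma UnitLift.nonempty {a : R} (ha : a ∈ J) : Nonempty (UnitLift P a) := by
  obtain ⟨p, hp⟩ := P.π_surjective (1 : R ⧸ J)
  obtain ⟨q, hq⟩ := P.exists_lift_of_π_eq_zero (p := a • p) (by
    rw [map_smul, hp]
    change Ideal.Quotient.mk J (a • 1) = 0
    simpa using Ideal.Quotient.eq_zero_iff_mem.mpr ha)
  exact ⟨⟨p, q, hp, hq⟩⟩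

variable {P P'} {z : R} {M : ModuleCat.{0} R} {n n' : ℕ}

lemma UnitLift.frac_coboundary_eq_zero (u : UnitLift P (z ^ n)) (g : P.complex.X 0 ⟶ M) :
    (ModuleCat.evalAt M u.q ≫ ModuleCat.ofHom (LocalizedQuotient.frac z M n))
      (P.complex.d 1 0 ≫ g) = 0 := by
  change LocalizedQuotient.frac z M n (g (P.complex.d 1 0 u.q)) = 0
  rw [u.d_q, map_smul, LocalizedQuotient.frac_pow_smul_self]

/-- The map `Ext¹(R ⧸ J, M) → M_z / M` when `z ^ n ∈ J`. -/
def UnitLift.toLocalizedQuotient (u : UnitLift P (z ^ n)) (M : ModuleCat.{0} R) :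
    ((Ext R (ModuleCat.{0} R) 1).obj (Opposite.op (ModuleCat.of R (R ⧸ J)))).obj M ⟶
      ModuleCat.of R (LocalizedQuotient z M) :=
  P.extOneDesc (ModuleCat.evalAt M u.q ≫ ModuleCat.ofHom (LocalizedQuotient.frac z M n))
    u.frac_coboundary_eq_zero

lemma UnitLift.map_toLocalizedQuotient (u : UnitLift P (z ^ n')) (u' : UnitLift P' (z ^ n))
    (hn : n ≤ n')
    (α : ModuleCat.of R (R ⧸ J) ⟶ ModuleCat.of R (R ⧸ J')) (hα : α (1 : R ⧸ J) = (1 : R ⧸ J')) :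
    ((Ext R (ModuleCat.{0} R) 1).map α.op).app M ≫ u.toLocalizedQuotient M =
      u'.toLocalizedQuotient M := by
  obtain ⟨k, rfl⟩ := Nat.exists_eq_add_of_le hn
  ext x
  obtain ⟨f, hf, h1, h2⟩ := P.exists_cocycle α P' (lift α P P') (lift_commutes_zero α P P') x
  refine (h2 _ u.frac_coboundary_eq_zero).trans
    (Eq.trans ?_ (h1 _ u'.frac_coboundary_eq_zero).symm)
  change LocalizedQuotient.frac z M (n + k) (f ((lift α P P').f 1 u.q)) =
    LocalizedQuotient.frac z M n (f u'.q)
  have hp : P'.π.f 0 ((lift α P P').f 0 u.p - u'.p) = 0 := by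
    have h3 : P'.π.f 0 ((lift α P P').f 0 u.p) = α (P.π.f 0 u.p) :=
      ConcreteCategory.congr_hom (lift_commutes_zero α P P') u.p
    rw [map_sub]
    exact sub_eq_zero_of_eq (h3.trans ((congrArg α u.π_p).trans (hα.trans u'.π_p.symm)))
  obtain ⟨s, hs⟩ := P'.exists_lift_of_π_eq_zero hp
  have h3 : P'.complex.d 1 0 ((lift α P P').f 1 u.q) =
      (lift α P P').f 0 (P.complex.d 1 0 u.q) :=
    ConcreteCategory.congr_hom ((lift α P P').comm 1 0) u.q
  obtain ⟨t, ht⟩ := P'.exists_lift_of_d_eq_zero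
    (p := (lift α P P').f 1 u.q - (z ^ k • u'.q + z ^ (n + k) • s)) (by
      rw [map_sub, map_add, map_smul, map_smul, hs, u'.d_q, h3, u.d_q, map_smul, smul_sub,
        smul_smul, ← pow_add, add_comm k n]
      abel)
  have h4 : f ((lift α P P').f 1 u.q - (z ^ k • u'.q + z ^ (n + k) • s)) = 0 := by
    rw [← ht]
    exact ConcreteCategory.congr_hom hf t
  rw [map_sub, sub_eq_zero] at h4
  rw [h4, map_add, map_smul, map_smul, map_add, LocalizedQuotient.frac_pow_smul_self,
    LocalizedQuotient.frac_add_pow_smul, add_zero]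

lemma UnitLift.exists_toLocalizedQuotient_eq (u : UnitLift P (z ^ n))
    (hJ : J ≤ Ideal.span {z ^ n}) (hreg : IsSMulRegular M z) (m : M) :
    ∃ x, u.toLocalizedQuotient M x = LocalizedQuotient.frac z M n m := by
  let mk : ModuleCat.of R R ⟶ ModuleCat.of R (R ⧸ J) := ModuleCat.ofHom J.mkQ
  have : Epi mk := (ModuleCat.epi_iff_surjective _).mpr (Submodule.mkQ_surjective J)
  let π : P.complex.X 0 ⟶ ModuleCat.of R (R ⧸ J) := P.π.f 0
  let h := Projective.factorThru π mk
  have hh (y) : Ideal.Quotient.mk J (h y) = π y :=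
    ConcreteCategory.congr_hom (Projective.factorThru_comp π mk) y
  have hmem (y) (hy : π y = 0) : ∃ b, h y = z ^ n * b := by
    have : h y ∈ J := Ideal.Quotient.eq_zero_iff_mem.mp ((hh y).trans hy)
    obtain ⟨b, hb⟩ := Ideal.mem_span_singleton.mp (hJ this)
    exact ⟨b, hb⟩
  have hex (y : P.complex.X 1) : ∃ m' : M, z ^ n • m' = (h (P.complex.d 1 0 y)) • m := by
    obtain ⟨b, hb⟩ := hmem (P.complex.d 1 0 y)
      (ConcreteCategory.congr_hom P.complex_d_comp_π_f_zero y)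
    exact ⟨b • m, by rw [hb, smul_smul]⟩
  choose f hf using hex
  have hinj : Function.Injective (fun m : M => z ^ n • m) := hreg.pow n
  let f' : P.complex.X 1 ⟶ M := ModuleCat.ofHom
    { toFun := f
      map_add' := fun x y => hinj (by simp only [smul_add, hf, map_add, add_smul])
      map_smul' := fun r x => hinj (by
        simp only [hf, map_smul, smul_eq_mul, mul_smul, RingHom.id_apply, smul_comm (z ^ n) r]) }
  obtain ⟨x, hx⟩ := P.exists_ext_class f' (by
    ext y
    apply hinj
    change z ^ n • f (P.complex.d 2 1 y) = z ^ n • 0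
    have : P.complex.d 1 0 (P.complex.d 2 1 y) = 0 :=
      ConcreteCategory.congr_hom (P.complex.d_comp_d 2 1 0) y
    rw [hf, this, map_zero, zero_smul, smul_zero])
  refine ⟨x, (hx _ _).trans ?_⟩
  change LocalizedQuotient.frac z M n (f u.q) = _
  have h1 : h u.p - 1 ∈ J := by
    rw [← Ideal.Quotient.eq_zero_iff_mem, map_sub, map_one, hh, sub_eq_zero]
    exact u.π_p
  obtain ⟨a, ha⟩ := Ideal.mem_span_singleton.mp (hJ h1)
  have h2 : f u.q = m + z ^ n • a • m := hinj (by
    change z ^ n • f u.q = z ^ n • (m + z ^ n • a • m)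
    rw [hf, u.d_q, map_smul, smul_assoc, sub_eq_iff_eq_add.mp ha, add_smul, one_smul, mul_smul,
      add_comm])
  rw [h2, map_add, LocalizedQuotient.frac_pow_smul_self, add_zero]

end

section
open CategoryTheory.Limits localCohomology
variable {R : Type} [CommRing R]

/-- The colimit cocone presenting `localCohomology J i` of `M` as a colimit of `Ext` modules. -/
def localCohomologyCocone (J : Ideal R) (i : ℕ) (M : ModuleCat.{0} R) :
    Cocone (diagram (idealPowersDiagram J) i ⋙ (evaluation _ _).obj M) :=
  ((evaluation _ _).obj M).mapCocone (colimit.cocone (diagram (idealPowersDiagram J) i))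

/-- `localCohomologyCocone J i M` is a colimit cocone. -/
def isColimitLocalCohomologyCocone (J : Ideal R) (i : ℕ) (M : ModuleCat.{0} R) :
    IsColimit (localCohomologyCocone J i M) :=
  isColimitOfPreserves _ (colimit.isColimit _)

lemma annihilator_le_annihilator_localCohomology (J : Ideal R) (i : ℕ) (M : ModuleCat.{0} R) :
    Module.annihilator R M ≤ Module.annihilator R ((localCohomology J i).obj M) := by
  intro r hr
  rw [Module.mem_annihilator] at hr ⊢
  intro x
  obtain ⟨t, y, rfl⟩ :=
    Concrete.isColimit_exists_rep _ (isColimitLocalCohomologyCocone J i M) x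
  refine (map_smul ((localCohomologyCocone J i M).ι.app t).hom r y).symm.trans ?_
  exact (congrArg _ (ProjectiveResolution.smul_ext_eq_zero i hr y)).trans (map_zero _)

/-- If `z` is a nonzerodivisor on `M`, then `H¹_{Rz}(M)` surjects onto `M_z / M`. -/
lemma exists_surjective_localCohomology_one {z : R} {M : ModuleCat.{0} R}
    (hreg : IsSMulRegular M z) :
    ∃ f : (localCohomology (Ideal.span {z}) 1).obj M →ₗ[R] LocalizedQuotient z M,
      Function.Surjective f := by
  have hmem (n : ℕ) : z ^ n ∈ (Ideal.span {z} : Ideal R) ^ n :=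
    Ideal.pow_mem_pow (Ideal.mem_span_singleton_self z) n
  let u (n : ℕ) : UnitLift (projectiveResolution (ModuleCat.of R (R ⧸ (Ideal.span {z}) ^ n)))
    (z ^ n) := (UnitLift.nonempty _ (hmem n)).some
  let c : Cocone (diagram (idealPowersDiagram (Ideal.span {z})) 1 ⋙ (evaluation _ _).obj M) :=
    { pt := ModuleCat.of R (LocalizedQuotient z M)
      ι :=
        { app := fun t => (u t.unop.unop).toLocalizedQuotient M
          naturality := by
            intro t t' w
            refine Eq.trans ?_ (Category.comp_id _).symm
            exact (u t'.unop.unop).map_toLocalizedQuotient (u t.unop.unop)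
              w.unop.unop.down.down _ rfl } }
  refine ⟨((isColimitLocalCohomologyCocone (Ideal.span {z}) 1 M).desc c).hom, fun a => ?_⟩
  obtain ⟨n, m, rfl⟩ := LocalizedQuotient.exists_frac_eq z a
  obtain ⟨x, hx⟩ := (u n).exists_toLocalizedQuotient_eq
    (Ideal.span_singleton_pow z n).le hreg m
  refine ⟨(localCohomologyCocone (Ideal.span {z}) 1 M).ι.app (Opposite.op (Opposite.op n)) x, ?_⟩
  refine Eq.trans ?_ hx
  exact ConcreteCategory.congr_hom ((isColimitLocalCohomologyCocone (Ideal.span {z}) 1 M).fac c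
    (Opposite.op (Opposite.op n))) x

lemma finite_torsionBySet_of_finite_ext {I : Ideal R} [IsNoetherianRing R] {M : ModuleCat.{0} R}
    (h : Module.Finite R
      (((Ext R (ModuleCat.{0} R) 0).obj (Opposite.op (ModuleCat.of R (R ⧸ I)))).obj M)) :
    Module.Finite R (Submodule.torsionBySet R M I) := by
  let e := (ModuleCat.extZeroIso (ModuleCat.of R (R ⧸ I)) M).toLinearEquiv
  have : Module.Finite R (ModuleCat.of R (ModuleCat.of R (R ⧸ I) ⟶ M)) := Module.Finite.equiv e
  have : Module.Finite R (LinearMap.range (ModuleCat.evalAt (X := ModuleCat.of R (R ⧸ I)) M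
    (1 : R ⧸ I)).hom) := inferInstance
  refine Module.Finite.of_injective (Submodule.inclusion (p := Submodule.torsionBySet R M I)
    (p' := LinearMap.range (ModuleCat.evalAt (X := ModuleCat.of R (R ⧸ I)) M
      (1 : R ⧸ I)).hom) fun m hm => ?_) (Submodule.inclusion_injective _)
  rw [Submodule.mem_torsionBySet_iff] at hm
  refine ⟨ModuleCat.ofHom (I.liftQ (LinearMap.toSpanSingleton R M m) fun a ha => ?_), ?_⟩
  · exact hm ⟨a, ha⟩
  · exact one_smul R m

end

/-- For a non-zero `I`-cofinite module `M` over a complete Noetherian local ring and a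
nonzerodivisor `z ∈ 𝔪` on `M`, we have `Ann_R H^1_{Rz}(M) = Ann_R M`. -/
theorem annihilator_localCohomology_one_eq (R : Type) [CommRing R] [IsNoetherianRing R]
    [IsLocalRing R] [IsAdicComplete (IsLocalRing.maximalIdeal R) R]
    (I : Ideal R) (M : Type) [AddCommGroup M] [Module R M] [Nontrivial M]
    (hM : IsCofinite R I M) (z : R) (hz : z ∈ IsLocalRing.maximalIdeal R)
    (hreg : ∀ m : M, z • m = 0 → m = 0) :
    Module.annihilator R
        ((localCohomology (Ideal.span {z}) 1).obj (ModuleCat.of R M)) =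
      Module.annihilator R M := by
  have hreg' : IsSMulRegular M z := (isSMulRegular_iff_right_eq_zero_of_smul).mpr hreg
  refine le_antisymm (fun r hr => ?_)
    (annihilator_le_annihilator_localCohomology _ _ (ModuleCat.of R M))
  obtain ⟨f, hf⟩ := exists_surjective_localCohomology_one (M := ModuleCat.of R M) hreg'
  rw [Module.mem_annihilator]
  intro m
  exact eq_zero_of_forall_eq_pow_smul hM.1 (finite_torsionBySet_of_finite_ext (hM.2 0)) hz hreg'
    fun n => smul_eq_zero_of_mem_annihilator_localizedQuotient hreg'
      (LinearMap.annihilator_le_of_surjective f hf hr) n m
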